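/- Let τ be a face of σ and let F = τ^⊥ ∩ σ^∨ be the corresponding face of σ^∨, with associated graded prime p_F of R. Then tr(ω) ⊆ p_F (i.e. the torus orbit of τ lies in the non-Gorenstein locus) if and only if there is no element m ∈ ℤ^n such that ⟨u_ρ, m⟩ = 1 holds for every primitive ray generator u_ρ of σ contained in τ. -/

import Mathlib

set_option synthInstance.maxHeartbeats 1000000
set_option maxHeartbeats 1000000

noncomputable section

variable {α : Type} [Fintype α]

/-- pairing of an integer vector with a real vector -/
def ipair (u : α → ℤ) (x : α → ℝ) : ℝ := ∑ j, (u j : ℝ) * x j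

/-- pairing of two integer vectors -/
def zpair (u m : α → ℤ) : ℤ := ∑ j, u j * m j

/-- pairing of two real vectors -/
def rpair (u x : α → ℝ) : ℝ := ∑ j, u j * x j

/-- the real vector associated to an integer vector -/
def toReal (m : α → ℤ) : α → ℝ := fun j => (m j : ℝ)

variable {ι : Type} [Fintype ι]

/-- the cone `σ` generated by the integer vectors `u i` -/
def genCone (u : ι → α → ℤ) : Set (α → ℝ) :=
  {x | ∃ c : ι → ℝ, (∀ i, 0 ≤ c i) ∧ x = ∑ i, c i • toReal (u i)}

/-- the dual cone `σ^∨` of the cone generated by the `u i` -/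
def dualCone (u : ι → α → ℤ) : Set (α → ℝ) := {x | ∀ i, 0 ≤ ipair (u i) x}

/-- the polyhedron `P_K` -/
def PK (u : ι → α → ℤ) : Set (α → ℝ) := {x | ∀ i, 1 ≤ ipair (u i) x}

/-- the polyhedron `P_{-K}` -/
def PmK (u : ι → α → ℤ) : Set (α → ℝ) := {x | ∀ i, (-1 : ℝ) ≤ ipair (u i) x}

/-- the cone generated by `u` is pointed -/
def IsPointed (u : ι → α → ℤ) : Prop := ∀ x ∈ genCone u, -x ∈ genCone u → x = 0

/-- an integer vector is primitive if the gcd of its coordinates is a unit -/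
def Primitive (m : α → ℤ) : Prop := IsUnit (Finset.univ.gcd m)

/-- the ray spanned by an integer vector -/
def ray (v : α → ℤ) : Set (α → ℝ) := {x | ∃ t : ℝ, 0 ≤ t ∧ x = t • toReal v}

/-- `u` lists exactly the primitive ray generators of the rational pointed cone `σ` that it
generates: `σ` is pointed, each `u i` is primitive, and each `u i` spans an extreme ray of `σ`. -/
def IsRaySetup (u : ι → α → ℤ) : Prop :=
  IsPointed u ∧ (∀ i, Primitive (u i)) ∧ ∀ i, IsExtreme ℝ (genCone u) (ray (u i))

variable (k : Type) [Field k]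

/-- the monomial `χ^m` in the Laurent polynomial ring `k[ℤ^α]` -/
def mono (m : α → ℤ) : AddMonoidAlgebra k (α → ℤ) := AddMonoidAlgebra.single m 1

/-- the toric ring `R = k[σ^∨ ∩ M]`, the subalgebra of `k[ℤ^α]` spanned by the monomials
`χ^m` with `m ∈ σ^∨ ∩ M` -/
def toricRing (u : ι → α → ℤ) : Subalgebra k (AddMonoidAlgebra k (α → ℤ)) :=
  Algebra.adjoin k {f | ∃ m : α → ℤ, toReal m ∈ dualCone u ∧ f = mono k m}

/-- the canonical module `ω`, the `R`-submodule of `k[ℤ^α]` spanned by the monomials `χ^m`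
with `m ∈ P_K ∩ M` -/
def canMod (u : ι → α → ℤ) : Submodule ↥(toricRing k u) (AddMonoidAlgebra k (α → ℤ)) :=
  Submodule.span ↥(toricRing k u) {f | ∃ m : α → ℤ, toReal m ∈ PK u ∧ f = mono k m}

/-- the trace ideal `tr(ω)` of the canonical module -/
def traceIdeal (u : ι → α → ℤ) : Ideal ↥(toricRing k u) :=
  Ideal.span {r | ∃ (φ : ↥(canMod k u) →ₗ[↥(toricRing k u)] ↥(toricRing k u))
    (x : ↥(canMod k u)), φ x = r}

/-- a face `F` of the dual cone `σ^∨`: the intersection of `σ^∨` with the hyperplane orthogonal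
to a supporting vector `w ∈ σ` -/
def IsFaceOfDual (u : ι → α → ℤ) (F : Set (α → ℝ)) : Prop :=
  ∃ w ∈ genCone u, F = {x ∈ dualCone u | rpair w x = 0}

/-- the graded prime ideal `p_F` associated to a face `F` of `σ^∨`, generated by the monomials
`χ^m` with `m ∈ (σ^∨ ∩ M) \ F` -/
def facePrime (u : ι → α → ℤ) (F : Set (α → ℝ)) : Ideal ↥(toricRing k u) :=
  Ideal.span {r | ∃ m : α → ℤ, toReal m ∈ dualCone u ∧ toReal m ∉ F ∧
    (r : AddMonoidAlgebra k (α → ℤ)) = mono k m}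

/-- `F[1]`: the intersection of all facet-defining hyperplanes containing `F`, translated by one
lattice length into the interior of `σ^∨` -/
def faceShift (u : ι → α → ℤ) (F : Set (α → ℝ)) : Set (α → ℝ) :=
  {x | ∀ i, (∀ y ∈ F, ipair (u i) y = 0) → ipair (u i) x = 1}

end

/-- a face `τ` of the cone `σ` generated by the `u i`: the intersection of `σ` with the
hyperplane orthogonal to a supporting vector `x ∈ σ^∨` -/
def IsFaceOfCone {α ι : Type} [Fintype α] [Fintype ι] (u : ι → α → ℤ)
    (τ : Set (α → ℝ)) : Prop :=
  ∃ x ∈ dualCone u, τ = {y ∈ genCone u | rpair y x = 0}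

section GeneratedCone

variable {α ι : Type} [Fintype ι]

theorem toReal_mem_genCone (u : ι → α → ℤ) (i : ι) : toReal (u i) ∈ genCone u := by
  classical
  refine ⟨Pi.single i 1, fun j => ?_, ?_⟩
  · by_cases h : j = i
    · subst h; simp
    · simp [h]
  · rw [Finset.sum_eq_single i] <;> simp +contextual

theorem smul_mem_genCone {u : ι → α → ℤ} {x : α → ℝ} (hx : x ∈ genCone u) {t : ℝ} (ht : 0 ≤ t) :
    t • x ∈ genCone u := by
  obtain ⟨c, hc, rfl⟩ := hx
  exact ⟨fun i => t * c i, fun i => mul_nonneg ht (hc i), by simp [Finset.smul_sum, smul_smul]⟩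

theorem convex_genCone (u : ι → α → ℤ) : Convex ℝ (genCone u) := by
  rintro _ ⟨c, hc, rfl⟩ _ ⟨d, hd, rfl⟩ a b ha hb -
  refine ⟨fun i => a * c i + b * d i,
    fun i => add_nonneg (mul_nonneg ha (hc i)) (mul_nonneg hb (hd i)), ?_⟩
  simp [Finset.smul_sum, smul_smul, add_smul, Finset.sum_add_distrib]

end GeneratedCone

section LatticePairing

variable {α ι : Type} [Fintype α]

theorem ipair_toReal (u m : α → ℤ) : ipair u (toReal m) = (zpair u m : ℝ) := by
  simp [ipair, zpair, toReal]

theorem rpair_toReal_left (u : α → ℤ) (x : α → ℝ) : rpair (toReal u) x = ipair u x := rfl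

theorem zpair_add (u m m' : α → ℤ) : zpair u (m + m') = zpair u m + zpair u m' := by
  simp [zpair, mul_add, Finset.sum_add_distrib]

theorem zpair_sub (u m m' : α → ℤ) : zpair u (m - m') = zpair u m - zpair u m' := by
  simp [zpair, mul_sub, Finset.sum_sub_distrib]

theorem zpair_smul (u : α → ℤ) (N : ℤ) (m : α → ℤ) : zpair u (N • m) = N * zpair u m := by
  simp only [zpair, Pi.smul_apply, smul_eq_mul, Finset.mul_sum]
  exact Finset.sum_congr rfl fun _ _ => by ring

theorem toReal_mem_dualCone_iff {u : ι → α → ℤ} {m : α → ℤ} :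
    toReal m ∈ dualCone u ↔ ∀ i, 0 ≤ zpair (u i) m := by
  simp [dualCone, ipair_toReal]

theorem toReal_mem_PK_iff {u : ι → α → ℤ} {m : α → ℤ} :
    toReal m ∈ PK u ↔ ∀ i, 1 ≤ zpair (u i) m := by
  simp only [PK, Set.mem_ofPred_eq, ipair_toReal]
  exact forall_congr' fun i => by exact_mod_cast Iff.rfl

theorem toReal_mem_dualCone_of_mem_PK {u : ι → α → ℤ} {m : α → ℤ} (h : toReal m ∈ PK u) :
    toReal m ∈ dualCone u :=
  toReal_mem_dualCone_iff.2 fun i => zero_le_one.trans (toReal_mem_PK_iff.1 h i)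

variable [Fintype ι]

theorem rpair_sum_smul (u : ι → α → ℤ) (c : ι → ℝ) (x : α → ℝ) :
    rpair (∑ i, c i • toReal (u i)) x = ∑ i, c i * ipair (u i) x := by
  simp only [rpair, ipair, Finset.sum_apply, Pi.smul_apply, smul_eq_mul, toReal, Finset.sum_mul,
    Finset.mul_sum]
  rw [Finset.sum_comm]
  exact Finset.sum_congr rfl fun _ _ => Finset.sum_congr rfl fun _ _ => by ring

/-- Every real vector admits a positive multiple close to a lattice vector. -/
theorem exists_pos_mul_sub_lt (x : α → ℝ) {ε : ℝ} (hε : 0 < ε) :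
    ∃ N : ℕ, 0 < N ∧ ∃ p : α → ℤ, ∀ j, |N * x j - p j| < ε := by
  have hK : IsCompact (Set.Icc (0 : α → ℝ) 1) := isCompact_Icc
  obtain ⟨a, -, φ, hφ, hlim⟩ := hK.tendsto_subseq
    (x := fun N : ℕ => fun j => Int.fract ((N : ℝ) * x j))
    (fun N => ⟨fun j => Int.fract_nonneg _, fun j => (Int.fract_lt_one _).le⟩)
  obtain ⟨K, hK⟩ := Metric.cauchySeq_iff.1 hlim.cauchySeq ε hε
  have hlt : φ K < φ (K + 1) := hφ (Nat.lt_succ_self K)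
  refine ⟨φ (K + 1) - φ K, Nat.sub_pos_of_lt hlt,
    fun j => ⌊(φ (K + 1) : ℝ) * x j⌋ - ⌊(φ K : ℝ) * x j⌋, fun j => ?_⟩
  have h := (dist_le_pi_dist _ _ j).trans_lt (hK (K + 1) (Nat.le_succ K) K le_rfl)
  rw [Real.dist_eq] at h
  simp only [Function.comp_apply, Int.fract] at h
  refine lt_of_eq_of_lt (congrArg abs ?_) h
  rw [Nat.cast_sub hlt.le]
  push_cast
  ring

/-- For every real vector there is a lattice vector on which the integral functionals `u i` vanish,
respectively are positive, wherever they do so on the given vector. -/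
theorem exists_lattice_point_zpair_pos (u : ι → α → ℤ) (x : α → ℝ) :
    ∃ p : α → ℤ, ∀ i, (ipair (u i) x = 0 → zpair (u i) p = 0) ∧
      (0 < ipair (u i) x → 0 < zpair (u i) p) := by
  set C : ℝ := 1 + ∑ i, ∑ j, |(u i j : ℝ)| with hC
  have hC0 : 0 < C := by positivity
  obtain ⟨δ, hδ, hδ1, hδx⟩ : ∃ δ : ℝ,
      0 < δ ∧ δ ≤ 1 ∧ ∀ i, 0 < ipair (u i) x → δ ≤ ipair (u i) x := by
    have hev : ∀ i, ∀ᶠ δ in nhdsWithin (0 : ℝ) (Set.Ioi 0),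
        0 < ipair (u i) x → δ ≤ ipair (u i) x := fun i => by
      by_cases h : 0 < ipair (u i) x
      · filter_upwards [Ioc_mem_nhdsGT h] with δ hδ _ using hδ.2
      · simp [h]
    have h01 : ∀ᶠ δ in nhdsWithin (0 : ℝ) (Set.Ioi 0), δ ∈ Set.Ioc (0 : ℝ) 1 :=
      Ioc_mem_nhdsGT zero_lt_one
    obtain ⟨δ, h1, h2⟩ := (h01.and (Filter.eventually_all.2 hev)).exists
    exact ⟨δ, h1.1, h1.2, h2⟩
  obtain ⟨N, hN, p, hp⟩ := exists_pos_mul_sub_lt x (div_pos hδ hC0)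
  have key : ∀ i, |N * ipair (u i) x - zpair (u i) p| < δ := fun i => by
    have hsum : ∑ j, |(u i j : ℝ)| < C := by
      have := Finset.single_le_sum (f := fun i => ∑ j, |(u i j : ℝ)|)
        (fun i _ => Finset.sum_nonneg fun j _ => abs_nonneg _) (Finset.mem_univ i)
      linarith
    have heq : N * ipair (u i) x - zpair (u i) p = ∑ j, (u i j : ℝ) * (N * x j - p j) := by
      simp only [ipair, zpair, Int.cast_sum, Int.cast_mul, Finset.mul_sum,
        ← Finset.sum_sub_distrib]
      exact Finset.sum_congr rfl fun _ _ => by ring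
    calc |N * ipair (u i) x - zpair (u i) p|
        ≤ ∑ j, |(u i j : ℝ)| * (δ / C) := by
          rw [heq]
          refine (Finset.abs_sum_le_sum_abs _ _).trans (Finset.sum_le_sum fun j _ => ?_)
          rw [abs_mul]
          exact mul_le_mul_of_nonneg_left (hp j).le (abs_nonneg _)
      _ = (∑ j, |(u i j : ℝ)|) * (δ / C) := (Finset.sum_mul ..).symm
      _ < C * (δ / C) := mul_lt_mul_of_pos_right hsum (div_pos hδ hC0)
      _ = δ := mul_div_cancel₀ _ hC0.ne'
  refine ⟨p, fun i => ⟨fun h => ?_, fun h => ?_⟩⟩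
  · have := key i
    rw [h, mul_zero, zero_sub, abs_neg] at this
    have h1 : |(zpair (u i) p : ℝ)| < 1 := this.trans_le hδ1
    exact Int.abs_lt_one_iff.1 (by exact_mod_cast h1)
  · have h1 := (abs_lt.1 (key i)).2
    have h2 := hδx i h
    have h3 : (1 : ℝ) ≤ N := by exact_mod_cast hN
    have h4 : ipair (u i) x ≤ N * ipair (u i) x := le_mul_of_one_le_left h.le h3
    have : (0 : ℝ) < zpair (u i) p := by linarith
    exact_mod_cast this

theorem Primitive.exists_zpair_eq_one {v : α → ℤ} (hv : Primitive v) : ∃ m, zpair v m = 1 := by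
  obtain ⟨g, hg⟩ := Finset.gcd_eq_sum_mul Finset.univ v
  obtain ⟨c, hc⟩ := hv.exists_right_inv
  refine ⟨c • g, ?_⟩
  rw [zpair_smul, ← hc, hg, mul_comm]
  exact congrArg (· * c) (Finset.sum_congr rfl fun _ _ => by ring)

theorem Primitive.eq_of_mem_ray {v w : α → ℤ} (hv : Primitive v) (hw : Primitive w)
    (h : toReal w ∈ ray v) : w = v := by
  obtain ⟨t, ht, hwt⟩ := h
  obtain ⟨m, hm⟩ := hv.exists_zpair_eq_one
  obtain ⟨m', hm'⟩ := hw.exists_zpair_eq_one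
  have hz : ∀ q : α → ℤ, (zpair w q : ℝ) = t * zpair v q := fun q => by
    have hj : ∀ j, (w j : ℝ) = t * v j := fun j => by simpa [toReal] using congrFun hwt j
    simp only [zpair, Int.cast_sum, Int.cast_mul, Finset.mul_sum, hj]
    exact Finset.sum_congr rfl fun _ _ => by ring
  have h1 := hz m
  have h2 := hz m'
  rw [hm, Int.cast_one, mul_one] at h1
  rw [hm', ← h1, Int.cast_one] at h2
  have h3 : zpair w m * zpair v m' = 1 := by exact_mod_cast h2.symm
  have h4 : 0 ≤ zpair w m := by exact_mod_cast h1.symm ▸ ht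
  have h5 : zpair w m = 1 := by
    rcases Int.eq_one_or_neg_one_of_mul_eq_one h3 with h | h <;> omega
  rw [h5, Int.cast_one] at h1
  funext j
  have := congrFun hwt j
  simp only [← h1, one_smul, toReal] at this
  exact_mod_cast this

/-- Extreme rays of a pointed polyhedral cone are exposed. -/
theorem IsRaySetup.exists_supporting {u : ι → α → ℤ} (hu : IsRaySetup u) (i : ι) :
    ∃ x : α → ℝ, ipair (u i) x = 0 ∧ ∀ j, u j ≠ u i → 0 < ipair (u j) x := by
  classical
  obtain ⟨hpt, hprim, hext⟩ := hu
  set A : Set (α → ℝ) := (fun j => toReal (u j)) '' {j | u j ≠ u i} with hA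
  set L : Submodule ℝ (α → ℝ) := Submodule.span ℝ {toReal (u i)} with hL
  have hsub : convexHull ℝ A ⊆ genCone u \ ray (u i) := by
    refine convexHull_min ?_ ((hext i).convex_sdiff (convex_genCone u))
    rintro _ ⟨j, hj, rfl⟩
    exact ⟨toReal_mem_genCone u j, fun h => hj ((hprim i).eq_of_mem_ray (hprim j) h)⟩
  have hdisj : Disjoint (convexHull ℝ A) (L : Set (α → ℝ)) := by
    rw [Set.disjoint_left]
    intro w hw hwL
    obtain ⟨hw1, hw2⟩ := hsub hw
    obtain ⟨s, rfl⟩ := Submodule.mem_span_singleton.1 hwL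
    rcases le_total 0 s with hs | hs
    · exact hw2 ⟨s, hs, rfl⟩
    · have h0 := hpt _ hw1 (by
        rw [← neg_smul]
        exact smul_mem_genCone (toReal_mem_genCone u i) (neg_nonneg.2 hs))
      exact hw2 (h0 ▸ ⟨0, le_rfl, by simp⟩)
  have hfin : A.Finite := (Set.toFinite _).image _
  obtain ⟨f, a, b, hfa, hab, hfb⟩ := geometric_hahn_banach_compact_closed (convex_convexHull ℝ A)
    (hfin.isCompact_convexHull ℝ) L.convex (Submodule.closed_of_finiteDimensional L) hdisj
  have hfL : f (toReal (u i)) = 0 := by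
    by_contra hne
    have := hfb ((b / f (toReal (u i))) • toReal (u i))
      (L.smul_mem _ (Submodule.mem_span_singleton_self _))
    rw [map_smul, smul_eq_mul, div_mul_cancel₀ _ hne] at this
    exact lt_irrefl _ this
  have hb : b < 0 := by simpa using hfb 0 L.zero_mem
  have hrep : ∀ v : α → ℤ, ipair v (fun j => -f (Pi.single j 1)) = -f (toReal v) := fun v => by
    have h : toReal v = ∑ j, (v j : ℝ) • (Pi.single j 1 : α → ℝ) := by
      funext l
      simp [toReal, Finset.sum_apply, Pi.single_apply]
    rw [h, map_sum, ← Finset.sum_neg_distrib]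
    simp [ipair]
  refine ⟨fun j => -f (Pi.single j 1), by rw [hrep, hfL, neg_zero], fun j hj => ?_⟩
  rw [hrep]
  have := hfa _ (subset_convexHull ℝ A ⟨j, hj, rfl⟩)
  linarith

/-- Each facet inequality of `P_K` is attained at a lattice point of `P_K`. -/
theorem IsRaySetup.exists_mem_PK_zpair_eq_one {u : ι → α → ℤ} (hu : IsRaySetup u) (i : ι) :
    ∃ c : α → ℤ, toReal c ∈ PK u ∧ zpair (u i) c = 1 := by
  obtain ⟨x, hx0, hx⟩ := hu.exists_supporting i
  obtain ⟨p, hp⟩ := exists_lattice_point_zpair_pos u x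
  obtain ⟨m, hm⟩ := (hu.2.1 i).exists_zpair_eq_one
  set N : ℤ := 1 + ∑ j, |zpair (u j) m|
  refine ⟨m + N • p, toReal_mem_PK_iff.2 fun j => ?_, ?_⟩
  · by_cases h : u j = u i
    · rw [h, zpair_add, zpair_smul, (hp i).1 hx0, hm]; simp
    · have h1 : 1 ≤ zpair (u j) p := (hp j).2 (hx j h)
      have h2 := Finset.single_le_sum (f := fun j => |zpair (u j) m|) (fun i _ => abs_nonneg _)
        (Finset.mem_univ j)
      have h3 := neg_abs_le (zpair (u j) m)
      have h4 : 0 ≤ |zpair (u j) m| := abs_nonneg _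
      rw [zpair_add, zpair_smul]
      nlinarith
  · rw [zpair_add, zpair_smul, (hp i).1 hx0, hm]; simp

theorem IsFaceOfCone.toReal_mem_dual_face_iff {u : ι → α → ℤ} {τ : Set (α → ℝ)}
    (hτ : IsFaceOfCone u τ) (m : α → ℤ) :
    toReal m ∈ {x ∈ dualCone u | ∀ y ∈ τ, rpair y x = 0} ↔
      toReal m ∈ dualCone u ∧ ∀ i, toReal (u i) ∈ τ → zpair (u i) m = 0 := by
  refine and_congr_right fun _ => ⟨fun h i hi => ?_, fun h y hy => ?_⟩
  · have := h _ hi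
    rw [rpair_toReal_left, ipair_toReal] at this
    exact_mod_cast this
  · obtain ⟨x, hx, rfl⟩ := hτ
    obtain ⟨⟨c, hc, rfl⟩, hyx⟩ := hy
    rw [rpair_sum_smul] at hyx ⊢
    rw [Finset.sum_eq_zero_iff_of_nonneg fun i _ => mul_nonneg (hc i) (hx i)] at hyx
    refine Finset.sum_eq_zero fun i hi => ?_
    rcases mul_eq_zero.1 (hyx i hi) with h0 | h0
    · rw [h0, zero_mul]
    · rw [ipair_toReal, h i ⟨toReal_mem_genCone u i, h0⟩, Int.cast_zero, mul_zero]

end LatticePairing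

section ToricRing

variable {α ι : Type} {k : Type} [Field k]

theorem mono_mul_mono (a b : α → ℤ) : mono k a * mono k b = mono k (a + b) := by
  simp [mono, AddMonoidAlgebra.single_mul_single]

theorem exists_add_of_coeff_mul_ne_zero {f g : AddMonoidAlgebra k (α → ℤ)} {m : α → ℤ}
    (h : (f * g).coeff m ≠ 0) :
    ∃ a b, f.coeff a ≠ 0 ∧ g.coeff b ≠ 0 ∧ a + b = m := by
  classical
  obtain ⟨a, ha, b, hb, hab⟩ := Finset.mem_add.1
    (AddMonoidAlgebra.support_coeff_mul_subset f g (Finsupp.mem_support_iff.2 h))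
  exact ⟨a, b, Finsupp.mem_support_iff.1 ha, Finsupp.mem_support_iff.1 hb, hab⟩

theorem eq_of_coeff_mono_ne_zero {a m : α → ℤ} (h : (mono k a).coeff m ≠ 0) : m = a := by
  by_contra hne
  exact h (Finsupp.single_eq_of_ne hne)

variable [Fintype α]

theorem mono_mem_toricRing {u : ι → α → ℤ} {m : α → ℤ} (hm : toReal m ∈ dualCone u) :
    mono k m ∈ toricRing k u :=
  Algebra.subset_adjoin ⟨m, hm, rfl⟩

theorem mono_mem_canMod {u : ι → α → ℤ} {m : α → ℤ} (hm : toReal m ∈ PK u) :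
    mono k m ∈ canMod k u :=
  Submodule.subset_span ⟨m, hm, rfl⟩

theorem toReal_mem_dualCone_of_coeff_ne_zero {u : ι → α → ℤ} {r : AddMonoidAlgebra k (α → ℤ)}
    (hr : r ∈ toricRing k u) {m : α → ℤ} (h : r.coeff m ≠ 0) : toReal m ∈ dualCone u := by
  induction hr using Algebra.adjoin_induction generalizing m with
  | mem f hf =>
    obtain ⟨a, ha, rfl⟩ := hf
    rwa [eq_of_coeff_mono_ne_zero h]
  | algebraMap c =>
    have hm : m = 0 := by
      by_contra hne
      exact h (Finsupp.single_eq_of_ne hne)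
    subst hm
    exact toReal_mem_dualCone_iff.2 fun i => by simp [zpair]
  | add f g _ _ ihf ihg =>
    by_cases hf : f.coeff m = 0
    · exact ihg fun hg => h (by simp [hf, hg])
    · exact ihf hf
  | mul f g _ _ ihf ihg =>
    obtain ⟨a, b, ha, hb, rfl⟩ := exists_add_of_coeff_mul_ne_zero h
    have ha' := toReal_mem_dualCone_iff.1 (ihf ha)
    have hb' := toReal_mem_dualCone_iff.1 (ihg hb)
    exact toReal_mem_dualCone_iff.2 fun i => by
      rw [zpair_add]; exact add_nonneg (ha' i) (hb' i)

/-- The elements of `p_F` have no monomial in `F`. -/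
theorem coeff_eq_zero_of_mem_facePrime {u : ι → α → ℤ} {F : Set (α → ℝ)}
    (hF : ∀ a b : α → ℤ, toReal a ∈ dualCone u → toReal b ∈ dualCone u →
      toReal (a + b) ∈ F → toReal b ∈ F)
    {r : ↥(toricRing k u)} (hr : r ∈ facePrime k u F) {m : α → ℤ} (hm : toReal m ∈ F) :
    (r : AddMonoidAlgebra k (α → ℤ)).coeff m = 0 := by
  induction hr using Submodule.span_induction generalizing m with
  | mem r hr =>
    obtain ⟨a, -, haF, hra⟩ := hr
    by_contra h
    rw [hra] at h
    exact haF (eq_of_coeff_mono_ne_zero h ▸ hm)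
  | zero => simp
  | add r s _ _ ihr ihs => simp [ihr hm, ihs hm]
  | smul s r _ ih =>
    by_contra h
    obtain ⟨a, b, ha, hb, rfl⟩ := exists_add_of_coeff_mul_ne_zero (by simpa using h)
    exact hb (ih (hF a b (toReal_mem_dualCone_of_coeff_ne_zero s.2 ha)
      (toReal_mem_dualCone_of_coeff_ne_zero r.2 hb) hm))

/-- An element of the toric ring without monomials in `F` lies in `p_F`. -/
theorem mem_facePrime_of_coeff_eq_zero {u : ι → α → ℤ} {F : Set (α → ℝ)} {r : ↥(toricRing k u)}
    (hr : ∀ m : α → ℤ, toReal m ∈ F → (r : AddMonoidAlgebra k (α → ℤ)).coeff m = 0) :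
    r ∈ facePrime k u F := by
  set f : AddMonoidAlgebra k (α → ℤ) := r.1
  set s := f.coeff.support
  have hs : ∀ m : s, toReal m.1 ∈ dualCone u := fun m =>
    toReal_mem_dualCone_of_coeff_ne_zero r.2 (Finsupp.mem_support_iff.1 m.2)
  have hsum : r = ∑ m : s, algebraMap k ↥(toricRing k u) (f.coeff m.1) *
      ⟨mono k m.1, mono_mem_toricRing (hs m)⟩ := by
    apply Subtype.ext
    rw [AddSubmonoidClass.coe_finsetSum]
    have h1 : ∀ m : s, ((algebraMap k ↥(toricRing k u) (f.coeff m.1) *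
        ⟨mono k m.1, mono_mem_toricRing (hs m)⟩ : ↥(toricRing k u)) :
          AddMonoidAlgebra k (α → ℤ)) =
        AddMonoidAlgebra.single m.1 (f.coeff m.1) := fun m => by
      rw [← Algebra.smul_def, Subalgebra.coe_smul]
      simp [mono]
    simp only [h1]
    rw [Finset.sum_coe_sort s
      (fun m => AddMonoidAlgebra.single m (f.coeff m))]
    apply AddMonoidAlgebra.coeff_injective
    rw [AddMonoidAlgebra.coeff_sum]
    exact (Finsupp.sum_single _).symm
  rw [hsum]
  refine Ideal.sum_mem _ fun m _ => Ideal.mul_mem_left _ _ (Ideal.subset_span ?_)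
  exact ⟨m.1, hs m, fun h => Finsupp.mem_support_iff.1 m.2 (hr _ h), rfl⟩

theorem mono_mul_mem_toricRing {u : ι → α → ℤ} {b : α → ℤ} (hb : ∀ i, -1 ≤ zpair (u i) b)
    {x : AddMonoidAlgebra k (α → ℤ)} (hx : x ∈ canMod k u) : mono k b * x ∈ toricRing k u := by
  induction hx using Submodule.span_induction with
  | mem x hx =>
    obtain ⟨a, ha, rfl⟩ := hx
    rw [mono_mul_mono]
    refine mono_mem_toricRing (toReal_mem_dualCone_iff.2 fun i => ?_)
    rw [zpair_add]
    linarith [hb i, toReal_mem_PK_iff.1 ha i]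
  | zero => simp
  | add x y _ _ hx hy => rw [mul_add]; exact add_mem hx hy
  | smul r x _ hx => rw [mul_smul_comm]; exact mul_mem r.2 hx

/-- `tr(ω)` contains the monomials with exponents in `(P_K ∩ M) + (P_{-K} ∩ M)`. -/
theorem mem_traceIdeal_of_eq_mono {u : ι → α → ℤ} {a b : α → ℤ} (ha : toReal a ∈ PK u)
    (hb : ∀ i, -1 ≤ zpair (u i) b) {r : ↥(toricRing k u)}
    (hr : (r : AddMonoidAlgebra k (α → ℤ)) = mono k (b + a)) : r ∈ traceIdeal k u := by
  let φ : ↥(canMod k u) →ₗ[↥(toricRing k u)] ↥(toricRing k u) :=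
    { toFun := fun x => ⟨mono k b * x.1, mono_mul_mem_toricRing hb x.2⟩
      map_add' := fun x y => Subtype.ext (mul_add _ _ _)
      map_smul' := fun r x => Subtype.ext (mul_smul_comm r (mono k b) x.1) }
  refine Ideal.subset_span ⟨φ, ⟨mono k a, mono_mem_canMod ha⟩, Subtype.ext ?_⟩
  rw [hr, ← mono_mul_mono]
  rfl

/-- A homomorphism `ω → R` is multiplication by a Laurent polynomial, so the coefficients of its
values on two monomials of `ω` agree up to a shift. -/
theorem coeff_apply_mono_add {u : ι → α → ℤ}
    (φ : ↥(canMod k u) →ₗ[↥(toricRing k u)] ↥(toricRing k u)) {a c : α → ℤ}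
    (ha : toReal a ∈ PK u) (hc : toReal c ∈ PK u) (m : α → ℤ) :
    (φ ⟨mono k c, mono_mem_canMod hc⟩ : AddMonoidAlgebra k (α → ℤ)).coeff (m + c - a) =
      (φ ⟨mono k a, mono_mem_canMod ha⟩ : AddMonoidAlgebra k (α → ℤ)).coeff m := by
  let a' : ↥(toricRing k u) :=
    ⟨mono k a, mono_mem_toricRing (toReal_mem_dualCone_of_mem_PK ha)⟩
  let c' : ↥(toricRing k u) :=
    ⟨mono k c, mono_mem_toricRing (toReal_mem_dualCone_of_mem_PK hc)⟩
  have h : c' • (⟨mono k a, mono_mem_canMod ha⟩ : ↥(canMod k u)) =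
      a' • (⟨mono k c, mono_mem_canMod hc⟩ : ↥(canMod k u)) :=
    Subtype.ext (mul_comm (mono k c) (mono k a))
  have h2 := congrArg (fun x => (φ x : AddMonoidAlgebra k (α → ℤ)).coeff (m + c)) h
  simp only [map_smul, smul_eq_mul, Subalgebra.coe_mul] at h2
  simp only [c', a', mono, AddMonoidAlgebra.coeff_single_mul_apply, one_mul] at h2
  rw [show -c + (m + c) = m by abel, show -a + (m + c) = m + c - a by abel] at h2
  exact h2.symm

end ToricRing

/-- Let `τ` be a face of `σ` and `F = τ^⊥ ∩ σ^∨` the corresponding face of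
`σ^∨`, with associated graded prime `p_F`.  Then `tr(ω) ⊆ p_F` (the torus orbit of `τ` lies in
the non-Gorenstein locus) iff there is no `m ∈ ℤ^n` with `⟨u_ρ, m⟩ = 1` for every primitive
ray generator `u_ρ` of `σ` contained in `τ`. -/
theorem orbit_in_nonGorenstein_iff
    {n : ℕ} {ι : Type} [Fintype ι] (u : ι → Fin n → ℤ) (hu : IsRaySetup u)
    (k : Type) [Field k] [IsAlgClosed k] [CharZero k]
    (τ : Set (Fin n → ℝ)) (hτ : IsFaceOfCone u τ) :
    traceIdeal k u ≤
        facePrime k u {x ∈ dualCone u | ∀ y ∈ τ, rpair y x = 0} ↔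
      ¬ ∃ m : Fin n → ℤ, ∀ i, toReal (u i) ∈ τ → zpair (u i) m = 1 := by
  classical
  set F : Set (Fin n → ℝ) := {x ∈ dualCone u | ∀ y ∈ τ, rpair y x = 0} with hFdef
  have hFmem : ∀ m : Fin n → ℤ, toReal m ∈ F ↔
      toReal m ∈ dualCone u ∧ ∀ i, toReal (u i) ∈ τ → zpair (u i) m = 0 :=
    hτ.toReal_mem_dual_face_iff
  constructor
  · rintro hle ⟨m, hm⟩
    obtain ⟨x, hx, rfl⟩ := id hτ
    obtain ⟨p, hp⟩ := exists_lattice_point_zpair_pos u x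
    have hpτ : ∀ i, toReal (u i) ∈ {y ∈ genCone u | rpair y x = 0} → zpair (u i) p = 0 :=
      fun i hi => (hp i).1 hi.2
    set N : ℤ := 1 + ∑ j, |zpair (u j) m|
    have hN : 0 ≤ N := by positivity
    have hbound : ∀ i, toReal (u i) ∉ {y ∈ genCone u | rpair y x = 0} →
        1 + |zpair (u i) m| ≤ N * zpair (u i) p := fun i hi => by
      have h1 : 1 ≤ zpair (u i) p := (hp i).2 (lt_of_le_of_ne (hx i)
        fun h => hi ⟨toReal_mem_genCone u i, h.symm⟩)
      have h2 := Finset.single_le_sum (f := fun j => |zpair (u j) m|) (fun i _ => abs_nonneg _)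
        (Finset.mem_univ i)
      exact (add_le_add_right h2 1).trans (le_mul_of_one_le_right hN h1)
    have ha : toReal (N • p + m) ∈ PK u := toReal_mem_PK_iff.2 fun i => by
      rw [zpair_add, zpair_smul]
      by_cases hi : toReal (u i) ∈ {y ∈ genCone u | rpair y x = 0}
      · rw [hpτ i hi, hm i hi]; simp
      · linarith [hbound i hi, neg_abs_le (zpair (u i) m)]
    have hb : ∀ i, -1 ≤ zpair (u i) (N • p - m) := fun i => by
      rw [zpair_sub, zpair_smul]
      by_cases hi : toReal (u i) ∈ {y ∈ genCone u | rpair y x = 0}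
      · rw [hpτ i hi, hm i hi]; simp
      · linarith [hbound i hi, le_abs_self (zpair (u i) m)]
    have hq : ∀ i, zpair (u i) (N • p - m + (N • p + m)) = 2 * (N * zpair (u i) p) := fun i => by
      rw [zpair_add, zpair_sub, zpair_add, zpair_smul]; ring
    have hqF : toReal (N • p - m + (N • p + m)) ∈ F := by
      refine (hFmem _).2 ⟨toReal_mem_dualCone_iff.2 fun i => ?_, fun i hi => ?_⟩
      · rw [hq]
        by_cases hi : toReal (u i) ∈ {y ∈ genCone u | rpair y x = 0}
        · rw [hpτ i hi]; simp
        · linarith [hbound i hi, abs_nonneg (zpair (u i) m)]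
      · rw [hq, hpτ i hi]; simp
    have hmem := hle (mem_traceIdeal_of_eq_mono (k := k) ha hb
      (r := ⟨_, mono_mem_toricRing ((hFmem _).1 hqF).1⟩) rfl)
    have h0 := coeff_eq_zero_of_mem_facePrime (fun a b ha hb hab => ?_) hmem hqF
    · simp [mono] at h0
    · refine (hFmem b).2 ⟨hb, fun i hi => ?_⟩
      have h1 := ((hFmem _).1 hab).2 i hi
      rw [zpair_add] at h1
      linarith [toReal_mem_dualCone_iff.1 ha i, toReal_mem_dualCone_iff.1 hb i]
  · intro hno
    refine Ideal.span_le.2 ?_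
    rintro _ ⟨φ, ⟨x, hx⟩, rfl⟩
    change φ ⟨x, hx⟩ ∈ facePrime k u F
    induction hx using Submodule.span_induction with
    | mem x hx =>
      obtain ⟨a, ha, rfl⟩ := hx
      refine mem_facePrime_of_coeff_eq_zero fun m hm => ?_
      by_contra hne
      refine hno ⟨a, fun i hi => ?_⟩
      obtain ⟨c, hc, hci⟩ := hu.exists_mem_PK_zpair_eq_one i
      have hmc := toReal_mem_dualCone_iff.1 (toReal_mem_dualCone_of_coeff_ne_zero (Subtype.coe_prop _)
        ((coeff_apply_mono_add φ ha hc m).trans_ne hne)) i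
      rw [zpair_sub, zpair_add, ((hFmem m).1 hm).2 i hi, hci] at hmc
      linarith [toReal_mem_PK_iff.1 ha i]
    | zero =>
      rw [show (⟨0, _⟩ : ↥(canMod k u)) = 0 from rfl, map_zero]
      exact zero_mem _
    | add x y hx hy ihx ihy =>
      rw [show (⟨x + y, _⟩ : ↥(canMod k u)) = ⟨x, hx⟩ + ⟨y, hy⟩ from rfl, map_add]
      exact add_mem ihx ihy
    | smul r x hx ih =>
      rw [show (⟨r • x, _⟩ : ↥(canMod k u)) = r • ⟨x, hx⟩ from rfl, map_smul]
      exact Ideal.mul_mem_left _ r ih
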